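/- arXiv:2301.00534 — 2 statements merged into one kernel-verified Lean document; each statement's English description precedes it below -/
import Mathlib

section
/- Let Λ be a non-semisimple self-injective Artin algebra of finite representation type, and let M be an indecomposable non-projective finitely generated Λ-module with property (*). Then the syzygy Ω(M) (the kernel of a projective cover P → M) is again an indecomposable non-projective module with property (*), and the cosyzygy Ω^{-1}(M) (the cokernel of an injective envelope M → I) is again an indecomposable non-projective module with property (*); consequently, all the short exact sequences 0 → Ω^{i+1}(M) → P^i → Ω^i(M) → 0 arising from a minimal projective resolution of M, and all the sequences 0 → Ω^{i}(M) → I^i → Ω^{i-1}(M) → 0 arising from a minimal injective resolution of M, are almost split sequences in mod-Λ. -/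
/-!
STATEMENT 17: Let Λ be a non-semisimple self-injective Artin algebra of finite
representation type, and M an indecomposable non-projective f.g. Λ-module with
property (*).  Then the syzygy Ω(M) = Ker(P → M) (for any projective cover) is
again indecomposable, non-projective, with property (*), and likewise the cosyzygy
Ω⁻¹(M) = Coker(M → I) (for any injective envelope); consequently all short exact
sequences arising from a minimal projective (resp. injective) resolution of M are
almost split.
-/

open Function

namespace Statement17

variable (k : Type) [CommRing k]
variable (Λ : Type) [Ring Λ] [Algebra k Λ]

/-- An indecomposable module. -/
def IndecMod (V : Type) [AddCommGroup V] [Module Λ V] : Prop :=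
  Nontrivial V ∧ ∀ N₁ N₂ : Submodule Λ V, IsCompl N₁ N₂ → N₁ = ⊥ ∨ N₂ = ⊥

/-- Finite representation type. -/
def FiniteRepType : Prop :=
  ∃ (n : ℕ) (rep : Fin n → ModuleCat.{0} Λ),
    ∀ (V : ModuleCat.{0} Λ), Module.Finite Λ V → IndecMod Λ V →
      ∃ i, Nonempty ((V : Type) ≃ₗ[Λ] (rep i : Type))

/-- `(i, p)` is an almost split sequence of finitely generated Λ-modules. -/
def IsAlmostSplitSeq {T B C : Type} [AddCommGroup T] [Module Λ T]
    [AddCommGroup B] [Module Λ B] [AddCommGroup C] [Module Λ C]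
    (i : T →ₗ[Λ] B) (p : B →ₗ[Λ] C) : Prop :=
  (Function.Injective i ∧ Function.Surjective p ∧ Function.Exact i p) ∧
  ¬ (∃ r : B →ₗ[Λ] T, r ∘ₗ i = LinearMap.id) ∧
  ¬ (∃ s : C →ₗ[Λ] B, p ∘ₗ s = LinearMap.id) ∧
  (∀ (Z : Type) [AddCommGroup Z] [Module Λ Z] [Module.Finite Λ Z],
    ∀ t : Z →ₗ[Λ] C, ¬ (∃ s : C →ₗ[Λ] Z, t ∘ₗ s = LinearMap.id) →
      ∃ l : Z →ₗ[Λ] B, p ∘ₗ l = t) ∧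
  (∀ (Z : Type) [AddCommGroup Z] [Module Λ Z] [Module.Finite Λ Z],
    ∀ t : T →ₗ[Λ] Z, ¬ (∃ r : Z →ₗ[Λ] T, r ∘ₗ t = LinearMap.id) →
      ∃ l : B →ₗ[Λ] Z, l ∘ₗ i = t)

/-- `p : P → V` is a projective cover. -/
def IsProjCover {P V : Type} [AddCommGroup P] [Module Λ P] [AddCommGroup V] [Module Λ V]
    (p : P →ₗ[Λ] V) : Prop :=
  Module.Projective Λ P ∧ Function.Surjective p ∧
    ∀ N : Submodule Λ P, N ⊔ LinearMap.ker p = ⊤ → N = ⊤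

/-- `j : V → I` is an injective envelope. -/
def IsInjEnvelope {V I : Type} [AddCommGroup V] [Module Λ V] [AddCommGroup I] [Module Λ I]
    (j : V →ₗ[Λ] I) : Prop :=
  Module.Injective Λ I ∧ Function.Injective j ∧
    ∀ N : Submodule Λ I, N ≠ ⊥ → N ⊓ LinearMap.range j ≠ ⊥

/-- Property (*): `V` is indecomposable, non-projective, and for every projective
cover `p : P → V` the short exact sequence 0 → Ker(p) → P → V → 0 is almost split. -/
def Pstar (V : Type) [AddCommGroup V] [Module Λ V] : Prop :=
  IndecMod Λ V ∧ ¬ Module.Projective Λ V ∧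
  ∀ (P : ModuleCat.{0} Λ) (p : (P : Type) →ₗ[Λ] V), Module.Finite Λ P →
    IsProjCover Λ p →
      IsAlmostSplitSeq Λ ((LinearMap.ker p).subtype) p

section Factorization

variable {R A B C X : Type} [Ring R] [AddCommGroup A] [Module R A] [AddCommGroup B] [Module R B]
  [AddCommGroup C] [Module R C] [AddCommGroup X] [Module R X]

theorem exists_factor_through_ker {i : A →ₗ[R] B} {p : B →ₗ[R] C} (hi : Injective i)
    (hex : Exact i p) (h : X →ₗ[R] B) (h0 : ∀ x, p (h x) = 0) :
    ∃ l : X →ₗ[R] A, ∀ x, i (l x) = h x := by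
  have hr : ∀ x, h x ∈ LinearMap.range i := fun x => (hex (h x)).1 (h0 x)
  refine ⟨(LinearEquiv.ofInjective i hi).symm.toLinearMap ∘ₗ h.codRestrict _ hr, fun x => ?_⟩
  have := LinearEquiv.apply_symm_apply (LinearEquiv.ofInjective i hi) (h.codRestrict _ hr x)
  exact congrArg Subtype.val this

theorem exists_factor_through_coker {i : A →ₗ[R] B} {p : B →ₗ[R] C} (hp : Surjective p)
    (hex : Exact i p) (h : B →ₗ[R] X) (h0 : ∀ x, h (i x) = 0) :
    ∃ l : C →ₗ[R] X, ∀ x, l (p x) = h x := by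
  have hk : LinearMap.ker p ≤ LinearMap.ker h := by
    intro b hb
    obtain ⟨a, rfl⟩ := (hex b).1 hb
    exact h0 a
  refine ⟨(LinearMap.ker p).liftQ h hk ∘ₗ (p.quotKerEquivOfSurjective hp).symm.toLinearMap,
    fun x => ?_⟩
  have : (p.quotKerEquivOfSurjective hp).symm (p x) = (LinearMap.ker p).mkQ x := by
    rw [LinearEquiv.symm_apply_eq]; rfl
  simp [this]

theorem exact_subtype_ker (p : B →ₗ[R] C) : Exact (LinearMap.ker p).subtype p := by
  intro b
  simp

theorem exact_mkQ_range (i : A →ₗ[R] B) : Exact i (LinearMap.range i).mkQ := by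
  intro b
  simp

theorem section_of_retraction {i : A →ₗ[R] B} {p : B →ₗ[R] C} (hp : Surjective p)
    (hex : Exact i p) {r : B →ₗ[R] A} (hr : r ∘ₗ i = LinearMap.id) :
    ∃ s : C →ₗ[R] B, p ∘ₗ s = LinearMap.id := by
  have hr' : ∀ a, r (i a) = a := fun a => LinearMap.congr_fun hr a
  obtain ⟨s, hs⟩ := exists_factor_through_coker hp hex (LinearMap.id - i ∘ₗ r)
    (fun x => by simp [hr'])
  refine ⟨s, LinearMap.ext fun c => ?_⟩
  obtain ⟨b, rfl⟩ := hp c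
  simp [hs, hex.apply_apply_eq_zero]

theorem retraction_of_section {i : A →ₗ[R] B} {p : B →ₗ[R] C} (hi : Injective i)
    (hex : Exact i p) {s : C →ₗ[R] B} (hs : p ∘ₗ s = LinearMap.id) :
    ∃ r : B →ₗ[R] A, r ∘ₗ i = LinearMap.id := by
  have hs' : ∀ c, p (s c) = c := fun c => LinearMap.congr_fun hs c
  obtain ⟨r, hr⟩ := exists_factor_through_ker hi hex (LinearMap.id - s ∘ₗ p)
    (fun x => by simp [hs'])
  refine ⟨r, LinearMap.ext fun a => hi ?_⟩
  simp [hr, hex.apply_apply_eq_zero]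

end Factorization

section Injective

variable {R : Type} [Ring R]

theorem injective_pi {ι : Type} (V : ι → Type) [∀ i, AddCommGroup (V i)] [∀ i, Module R (V i)]
    (hV : ∀ i, Module.Injective R (V i)) : Module.Injective R (∀ i, V i) := by
  refine ⟨fun X Y _ _ _ _ f hf g => ?_⟩
  choose h hh using fun i => (hV i).out f hf (LinearMap.proj i ∘ₗ g)
  exact ⟨LinearMap.pi h, fun x => funext fun i => hh i x⟩

theorem injective_of_retraction {V W : Type} [AddCommGroup V] [Module R V] [AddCommGroup W]
    [Module R W] (hW : Module.Injective R W) (i : V →ₗ[R] W) (r : W →ₗ[R] V)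
    (hr : r ∘ₗ i = LinearMap.id) : Module.Injective R V := by
  refine ⟨fun X Y _ _ _ _ f hf g => ?_⟩
  obtain ⟨h, hh⟩ := hW.out f hf (i ∘ₗ g)
  refine ⟨r ∘ₗ h, fun x => ?_⟩
  simpa [hh] using LinearMap.congr_fun hr (g x)

theorem retraction_of_injective {V W : Type} [AddCommGroup V] [Module R V] [AddCommGroup W]
    [Module R W] (hV : Module.Injective R V) {i : V →ₗ[R] W} (hi : Injective i) :
    ∃ r : W →ₗ[R] V, r ∘ₗ i = LinearMap.id := by
  obtain ⟨r, hr⟩ := hV.out i hi LinearMap.id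
  exact ⟨r, LinearMap.ext hr⟩

/-- Over a self-injective ring, finitely generated projective modules are injective. -/
theorem injective_of_projective (hself : Module.Injective R R) (P : Type) [AddCommGroup P]
    [Module R P] [Module.Finite R P] [Module.Projective R P] : Module.Injective R P := by
  obtain ⟨n, f, hf⟩ := Module.Finite.exists_fin' R P
  obtain ⟨s, hs⟩ := Module.projective_lifting_property f LinearMap.id hf
  exact injective_of_retraction (injective_pi _ fun _ => hself) s f hs

end Injective

section Cogenerator

variable {R : Type} [Ring R]

/-- An artinian module whose elements are separated by maps to `W` embeds in a finite power. -/
theorem exists_injective_pi {Z W : Type} [AddCommGroup Z] [Module R Z] [IsArtinian R Z]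
    [AddCommGroup W] [Module R W] (h : ∀ z : Z, (∀ f : Z →ₗ[R] W, f z = 0) → z = 0) :
    ∃ (n : ℕ) (f : Z →ₗ[R] (Fin n → W)), Injective f := by
  classical
  obtain ⟨s, hs⟩ := Finset.exists_inf_le (fun f : Z →ₗ[R] W => LinearMap.ker f)
  refine ⟨s.card, LinearMap.pi fun i => (s.equivFin.symm i : Z →ₗ[R] W), ?_⟩
  refine (injective_iff_map_eq_zero _).2 fun z hz => h z fun f => ?_
  refine hs f (?_ : z ∈ s.inf fun f : Z →ₗ[R] W => LinearMap.ker f)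
  rw [Submodule.mem_finsetInf]
  intro g hg
  simpa using congrFun hz (s.equivFin ⟨g, hg⟩)

theorem simple_equiv_of_annihilator_le [IsArtinianRing R] (S T : Type) [AddCommGroup S]
    [Module R S] [AddCommGroup T] [Module R T] [IsSimpleModule R S] [IsSimpleModule R T]
    (h : Module.annihilator R T ≤ Module.annihilator R S) : Nonempty (S ≃ₗ[R] T) := by
  obtain ⟨n, f, hf⟩ := exists_injective_pi (R := R) (Z := R ⧸ Module.annihilator R T) (W := T) (by
    intro z hz
    obtain ⟨x, rfl⟩ := Submodule.mkQ_surjective _ z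
    rw [← LinearMap.mem_ker, Submodule.ker_mkQ, Module.mem_annihilator]
    intro t
    have := hz (Submodule.liftQ _ (LinearMap.toSpanSingleton R T t)
      (fun a ha => by simpa using Module.mem_annihilator.1 ha t))
    rwa [Submodule.mkQ_apply, Submodule.liftQ_apply] at this)
  have : IsSemisimpleModule R (R ⧸ Module.annihilator R T) := IsSemisimpleModule.of_injective f hf
  have := IsSimpleModule.nontrivial R S
  obtain ⟨s, hs⟩ := exists_ne (0 : S)
  let g : (R ⧸ Module.annihilator R T) →ₗ[R] S :=
    Submodule.liftQ _ (LinearMap.toSpanSingleton R S s)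
      (fun a ha => by simpa using Module.mem_annihilator.1 (h ha) s)
  have hg : Surjective g := by
    refine LinearMap.surjective_of_ne_zero fun h0 => hs ?_
    have := LinearMap.congr_fun h0 ((Module.annihilator R T).mkQ 1)
    rw [Submodule.mkQ_apply, Submodule.liftQ_apply] at this
    simpa using this
  obtain ⟨σ, hσ⟩ := IsSemisimpleModule.lifting_property g hg LinearMap.id
  have hfs : f (σ s) ≠ 0 := fun h0 => hs <| by
    rw [← LinearMap.id_apply (R := R) s, ← hσ, LinearMap.comp_apply,
      (injective_iff_map_eq_zero f).1 hf _ h0, map_zero]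
  obtain ⟨i, hi⟩ := Function.ne_iff.1 hfs
  exact ⟨.ofBijective (LinearMap.proj i ∘ₗ f ∘ₗ σ)
    (LinearMap.bijective_of_ne_zero fun h0 => hi (LinearMap.congr_fun h0 s))⟩

theorem indecMod_of_isSimpleModule (S : Type) [AddCommGroup S] [Module R S]
    [IsSimpleModule R S] : IndecMod R S := by
  refine ⟨IsSimpleModule.nontrivial R S, fun N₁ N₂ h => ?_⟩
  rcases eq_bot_or_eq_top N₁ with h₁ | h₁
  · exact .inl h₁
  · exact .inr (by simpa [h₁] using h.inf_eq_bot)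

/-- In a self-injective Artin algebra, every proper two-sided ideal is killed on the left
by some simple left ideal. -/
theorem exists_simple_mul_annihilator_eq_zero (A : Type) [CommRing A] [Algebra A R]
    [Module.Finite A R] [IsArtinianRing A] (hself : Module.Injective R R) (I : Ideal R)
    [I.IsTwoSided] (hI : I ≠ ⊤) :
    ∃ T : Submodule R R, IsSimpleModule R T ∧ ∀ x ∈ T, ∀ a ∈ I, x * a = 0 := by
  have : IsArtinianRing R := IsArtinianRing.of_finite A R
  let L : Submodule R R :=
    { carrier := {x | ∀ a ∈ I, x * a = 0}
      add_mem' := fun hx hy a ha => by rw [add_mul, hx a ha, hy a ha, add_zero]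
      zero_mem' := fun a _ => zero_mul a
      smul_mem' := fun c x hx a ha => by rw [smul_eq_mul, mul_assoc, hx a ha, mul_zero] }
  have hL : L ≠ ⊥ := by
    intro hbot
    obtain ⟨n, a, ha⟩ := Submodule.fg_iff_exists_fin_generating_family.1
      (IsNoetherian.noetherian (I.restrictScalars A))
    have haI : ∀ i, a i ∈ I := fun i => by
      have : a i ∈ Submodule.span A (Set.range a) := Submodule.subset_span ⟨i, rfl⟩
      rwa [ha] at this
    let f : R →ₗ[R] (Fin n → R) := LinearMap.pi fun i => LinearMap.toSpanSingleton R R (a i)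
    have hf : Injective f := by
      refine (injective_iff_map_eq_zero f).2 fun x hx => ?_
      have hxL : x ∈ L := by
        intro b hb
        have hb' : b ∈ Submodule.span A (Set.range a) := by rw [ha]; exact hb
        induction hb' using Submodule.span_induction with
        | mem y hy =>
          obtain ⟨i, rfl⟩ := hy
          exact congrFun hx i
        | zero => simp
        | add y z hy hz h1 h2 =>
          rw [ha] at hy hz
          rw [mul_add, h1 hy, h2 hz, add_zero]
        | smul c y hy h1 =>
          rw [ha] at hy
          rw [Algebra.mul_smul_comm, h1 hy, smul_zero]
      rwa [hbot] at hxL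
    obtain ⟨g, hg⟩ := hself.out f hf LinearMap.id
    apply hI
    rw [Ideal.eq_top_iff_one]
    have h1 : g (f 1) = 1 := hg 1
    rw [← h1, LinearMap.pi_apply_eq_sum_univ g (f 1)]
    refine Submodule.sum_mem _ fun i _ => ?_
    have : f 1 i = a i := one_mul (a i)
    rw [this, smul_eq_mul]
    exact Ideal.mul_mem_right _ _ (haI i)
  obtain ⟨T, hT, hTL⟩ := (eq_bot_or_exists_atom_le L).resolve_left hL
  exact ⟨T, isSimpleModule_iff_isAtom.2 hT, fun x hx => hTL hx⟩

/-- A self-injective Artin algebra of finite representation type contains every simple module. -/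
theorem exists_injective_of_isSimpleModule (A : Type) [CommRing A] [Algebra A R]
    [Module.Finite A R] [IsArtinianRing A] (hself : Module.Injective R R)
    (hrep : FiniteRepType R) (S : Type) [AddCommGroup S] [Module R S] [IsSimpleModule R S] :
    ∃ f : S →ₗ[R] R, Injective f := by
  have : IsArtinianRing R := IsArtinianRing.of_finite A R
  let 𝒜 : Set (Ideal R) := {I | ∃ V : ModuleCat.{0} R, IsSimpleModule R V ∧
    Module.annihilator R V = I}
  have hfin : Finite 𝒜 := by
    obtain ⟨n, rep, h⟩ := hrep
    refine Set.Finite.subset (Set.finite_range fun i => Module.annihilator R (rep i)) ?_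
    rintro _ ⟨V, hV, rfl⟩
    obtain ⟨i, ⟨e⟩⟩ := h V inferInstance (indecMod_of_isSimpleModule V)
    exact ⟨i, e.symm.annihilator_eq⟩
  have key : ∀ I : 𝒜, ∃ T : Submodule R R, IsSimpleModule R T ∧ ∀ x ∈ T, ∀ a ∈ I.1, x * a = 0 := by
    rintro ⟨_, V, hV, rfl⟩
    have := IsSimpleModule.nontrivial R V
    refine exists_simple_mul_annihilator_eq_zero A hself (Module.annihilator R V) fun htop => ?_
    obtain ⟨v, hv⟩ := exists_ne (0 : V)
    exact hv (by simpa using Module.mem_annihilator.1 ((Ideal.eq_top_iff_one _).1 htop) v)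
  choose T hT hTI using key
  let σ : 𝒜 → 𝒜 := fun I => ⟨Module.annihilator R (T I), ModuleCat.of R (T I), hT I, rfl⟩
  have hσ : Injective σ := by
    rintro I I' h
    have hann : Module.annihilator R (T I) = Module.annihilator R (T I') := congrArg Subtype.val h
    obtain ⟨e⟩ := simple_equiv_of_annihilator_le (T I) (T I') hann.ge
    have := IsSimpleModule.nontrivial R (T I)
    obtain ⟨x, hx⟩ := exists_ne (0 : T I)
    obtain ⟨g, hg⟩ := hself.out (T I).subtype (Submodule.subtype_injective _)
      ((T I').subtype ∘ₗ e.toLinearMap)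
    have hy : (x : R) * g 1 = e x := by
      rw [← smul_eq_mul, ← map_smul, smul_eq_mul, mul_one]
      exact hg x
    have hyI : ∀ a ∈ I.1, (e x : R) * a = 0 := fun a ha => by
      rw [← hy, mul_assoc]
      exact hTI I x x.2 _ (Ideal.mul_mem_left _ _ ha)
    have hyI' : ∀ a ∈ I'.1, (e x : R) * a = 0 := hTI I' _ (e x).2
    have hne : I.1 ⊔ I'.1 ≠ ⊤ := by
      intro htop
      obtain ⟨a, ha, b, hb, hab⟩ := Submodule.mem_sup.1 ((Ideal.eq_top_iff_one _).1 htop)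
      apply hx
      apply e.injective
      apply Subtype.ext
      rw [map_zero, ZeroMemClass.coe_zero, ← mul_one (e x : R), ← hab, mul_add, hyI a ha,
        hyI' b hb, add_zero]
    obtain ⟨m, hm, hle⟩ := Ideal.exists_le_maximal _ hne
    have hsimple : IsSimpleModule R (R ⧸ m) := isSimpleModule_iff_isCoatom.2 hm.out
    have hquot : ∀ J : 𝒜, J.1 ≤ m → J.1 = Module.annihilator R (R ⧸ m) := by
      rintro ⟨_, V, hV, rfl⟩ hJ
      obtain ⟨e⟩ := simple_equiv_of_annihilator_le (R := R) (R ⧸ m) V (by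
        intro a ha
        rw [Module.mem_annihilator]
        intro z
        obtain ⟨b, rfl⟩ := Submodule.mkQ_surjective _ z
        rw [← map_smul, ← LinearMap.mem_ker, Submodule.ker_mkQ, smul_eq_mul]
        exact hJ (Ideal.mul_mem_right _ _ ha))
      exact e.symm.annihilator_eq
    exact Subtype.ext ((hquot I (le_sup_left.trans hle)).trans
      (hquot I' (le_sup_right.trans hle)).symm)
  obtain ⟨I, hI⟩ := (Finite.injective_iff_surjective.1 hσ)
    ⟨Module.annihilator R S, ModuleCat.of R S, ‹_›, rfl⟩
  have hann : Module.annihilator R (T I) = Module.annihilator R S := congrArg Subtype.val hI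
  obtain ⟨e⟩ := simple_equiv_of_annihilator_le S (T I) hann.le
  exact ⟨(T I).subtype ∘ₗ e.toLinearMap, (Submodule.subtype_injective _).comp e.injective⟩

theorem exists_injective_to_free [IsArtinianRing R] (hself : Module.Injective R R)
    (hsimple : ∀ (S : Type) [AddCommGroup S] [Module R S] [IsSimpleModule R S],
      ∃ f : S →ₗ[R] R, Injective f)
    (Z : Type) [AddCommGroup Z] [Module R Z] [Module.Finite R Z] :
    ∃ (n : ℕ) (f : Z →ₗ[R] (Fin n → R)), Injective f := by
  refine exists_injective_pi fun z hz => by_contra fun hz0 => ?_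
  obtain ⟨S, hS, hSz⟩ := (eq_bot_or_exists_atom_le (Submodule.span R {z})).resolve_left
    (by simpa using hz0)
  have : IsSimpleModule R S := isSimpleModule_iff_isAtom.2 hS
  have := IsSimpleModule.nontrivial R S
  obtain ⟨f, hf⟩ := hsimple S
  obtain ⟨g, hg⟩ := hself.out S.subtype (Submodule.subtype_injective _) f
  obtain ⟨x, hx⟩ := exists_ne (0 : S)
  obtain ⟨c, hc⟩ := Submodule.mem_span_singleton.1 (hSz x.2)
  apply hx
  apply hf
  rw [← hg, map_zero, Submodule.subtype_apply, ← hc, map_smul, hz g, smul_zero]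

/-- Finitely generated injective modules are projective when all simple modules embed in `R`. -/
theorem projective_of_injective [IsArtinianRing R] (hself : Module.Injective R R)
    (hsimple : ∀ (S : Type) [AddCommGroup S] [Module R S] [IsSimpleModule R S],
      ∃ f : S →ₗ[R] R, Injective f)
    (V : Type) [AddCommGroup V] [Module R V] [Module.Finite R V] (hV : Module.Injective R V) :
    Module.Projective R V := by
  obtain ⟨n, f, hf⟩ := exists_injective_to_free hself hsimple V
  obtain ⟨r, hr⟩ := retraction_of_injective hV hf
  exact Module.Projective.of_split f r hr

end Cogenerator

section Endomorphisms

variable {R V : Type} [Ring R] [AddCommGroup V] [Module R V]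

theorem le_jacobson_of_superfluous {K : Submodule R V}
    (hK : ∀ N : Submodule R V, N ⊔ K = ⊤ → N = ⊤) : K ≤ Module.jacobson R V := by
  refine le_sInf fun m (hm : IsCoatom m) => by_contra fun h => hm.1 (hK m ?_)
  exact hm.2 _ (left_lt_sup.2 h)

theorem bijective_of_sub_mem_jacobson [IsNoetherian R V] (u : V →ₗ[R] V)
    (hu : ∀ x, u x - x ∈ Module.jacobson R V) : Bijective u := by
  refine IsNoetherian.bijective_of_surjective_endomorphism u (LinearMap.range_eq_top.1 ?_)
  refine (eq_top_or_exists_le_coatom (LinearMap.range u)).resolve_right ?_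
  rintro ⟨m, hm, hle⟩
  refine hm.1 (eq_top_iff.2 fun x _ => ?_)
  have h1 : u x - x ∈ m := (sInf_le hm : Module.jacobson R V ≤ m) (hu x)
  have h2 : u x ∈ m := hle ⟨x, rfl⟩
  simpa using m.sub_mem h2 h1

theorem bijective_of_eq_on_simple [IsArtinian R V] (u : V →ₗ[R] V)
    (hu : ∀ S : Submodule R V, IsSimpleModule R S → ∀ x ∈ S, u x = x) : Bijective u := by
  refine IsArtinian.bijective_of_injective_endomorphism u (LinearMap.ker_eq_bot.1 ?_)
  refine (eq_bot_or_exists_atom_le (LinearMap.ker u)).resolve_right ?_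
  rintro ⟨S, hS, hle⟩
  refine hS.1 (eq_bot_iff.2 fun x hx => ?_)
  have h1 := hu S (isSimpleModule_iff_isAtom.2 hS) x hx
  have h2 : u x = 0 := hle hx
  exact h1.symm.trans h2

/-- Fitting's lemma: over an indecomposable module of finite length, the identity plus a
non-invertible endomorphism is invertible. -/
theorem IndecMod.bijective_of_eq_add [IsArtinian R V] [IsNoetherian R V] (hV : IndecMod R V)
    (f u : V →ₗ[R] V) (hf : ¬ Bijective f) (hu : ∀ x, u x = x + f x) : Bijective u := by
  obtain ⟨n, hn⟩ := Filter.eventually_atTop.1 (LinearMap.eventually_isCompl_ker_pow_range_pow f)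
  have hn1 := hn (n + 1) (Nat.le_succ n)
  rcases hV.2 _ _ hn1 with h | h
  · refine absurd (IsArtinian.bijective_of_injective_endomorphism f ?_) hf
    have hinj := LinearMap.ker_eq_bot.1 h
    rw [pow_succ] at hinj
    exact Injective.of_comp hinj
  · have hnil : IsNilpotent f := ⟨n + 1, LinearMap.range_eq_bot.1 h⟩
    have hunit : IsUnit (1 + f : Module.End R V) := hnil.isUnit_one_add
    have heq : u = 1 + f := LinearMap.ext fun x => by simp [hu]
    exact (Module.End.isUnit_iff _).1 (heq ▸ hunit)

/-- A map which becomes bijective after precomposition is a split epimorphism. -/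
theorem section_of_bijective_comp {W : Type} [AddCommGroup W] [Module R W] (t : W →ₗ[R] V)
    (s : V →ₗ[R] W) (h : Bijective (t ∘ₗ s)) : ∃ s' : V →ₗ[R] W, t ∘ₗ s' = LinearMap.id := by
  refine ⟨s ∘ₗ (LinearEquiv.ofBijective _ h).symm.toLinearMap, LinearMap.ext fun x => ?_⟩
  exact (LinearEquiv.ofBijective _ h).apply_symm_apply x

/-- A map which becomes bijective after postcomposition is a split monomorphism. -/
theorem retraction_of_bijective_comp {W : Type} [AddCommGroup W] [Module R W] (t : V →ₗ[R] W)
    (r : W →ₗ[R] V) (h : Bijective (r ∘ₗ t)) : ∃ r' : W →ₗ[R] V, r' ∘ₗ t = LinearMap.id := by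
  refine ⟨(LinearEquiv.ofBijective _ h).symm.toLinearMap ∘ₗ r, LinearMap.ext fun x => ?_⟩
  exact (LinearEquiv.ofBijective _ h).symm_apply_apply x

end Endomorphisms

section ProjectiveCover

variable {R : Type} [Ring R]

theorem exists_isProjCover [IsArtinianRing R] (V : Type) [AddCommGroup V] [Module R V]
    [Module.Finite R V] :
    ∃ (P : ModuleCat.{0} R) (p : (P : Type) →ₗ[R] V), Module.Finite R P ∧ IsProjCover R p := by
  obtain ⟨n, f, hf⟩ := Module.Finite.exists_fin' R V
  obtain ⟨N, hN, hmin⟩ := WellFounded.has_min (wellFounded_lt (α := Submodule R (Fin n → R)))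
    {N | N.map f = ⊤} ⟨⊤, by simpa using LinearMap.range_eq_top.2 hf⟩
  let p : N →ₗ[R] V := f ∘ₗ N.subtype
  have hp : Surjective p := by
    rw [← LinearMap.range_eq_top, LinearMap.range_comp, Submodule.range_subtype]
    exact hN
  have hsup : ∀ L : Submodule R N, L ⊔ LinearMap.ker p = ⊤ → L = ⊤ := by
    intro L hL
    have hmap : L.map p = ⊤ := by
      have := congrArg (Submodule.map p) hL
      rwa [Submodule.map_sup, (LinearMap.le_ker_iff_map).1 le_rfl, sup_bot_eq, Submodule.map_top,
        LinearMap.range_eq_top.2 hp] at this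
    have h1 : (L.map N.subtype).map f = ⊤ := by rw [← Submodule.map_comp]; exact hmap
    have h2 : L.map N.subtype = N :=
      eq_of_le_of_not_lt (Submodule.map_subtype_le N L) (hmin _ h1)
    apply Submodule.map_injective_of_injective N.subtype_injective
    rw [h2, Submodule.map_top, Submodule.range_subtype]
  obtain ⟨g, hg⟩ := Module.projective_lifting_property p f hp
  have hpg : ∀ x, p (g x) = f x := fun x => LinearMap.congr_fun hg x
  have hbij : Bijective (g ∘ₗ N.subtype) := by
    refine IsNoetherian.bijective_of_surjective_endomorphism _ (LinearMap.range_eq_top.1 ?_)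
    refine hsup _ (eq_top_iff.2 fun x _ => ?_)
    rw [← add_sub_cancel ((g ∘ₗ N.subtype) x) x]
    refine Submodule.add_mem_sup ⟨x, rfl⟩ ?_
    rw [LinearMap.mem_ker, map_sub, sub_eq_zero]
    exact (hpg x).symm
  obtain ⟨r, hr⟩ := retraction_of_bijective_comp N.subtype g hbij
  exact ⟨ModuleCat.of R N, p, inferInstanceAs (Module.Finite R N),
    Module.Projective.of_split N.subtype r hr, hp, hsup⟩

end ProjectiveCover

section AlmostSplit

variable {R : Type} [Ring R]

theorem IsAlmostSplitSeq.indecMod_left {K P M : Type} [AddCommGroup K] [Module R K]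
    [AddCommGroup P] [Module R P] [AddCommGroup M] [Module R M] {i : K →ₗ[R] P} {p : P →ₗ[R] M}
    (h : IsAlmostSplitSeq R i p) [IsNoetherian R K] : IndecMod R K := by
  obtain ⟨-, hi, -, -, hleft⟩ := h
  refine ⟨not_subsingleton_iff_nontrivial.1 fun _ => hi ⟨0, Subsingleton.elim _ _⟩, ?_⟩
  have key : ∀ (A B : Submodule R K) (hAB : IsCompl A B), B ≠ ⊥ →
      ∃ l : P →ₗ[R] K, ∀ x, l (i x) = A.projection B hAB x := by
    intro A B hAB hB
    obtain ⟨l, hl⟩ := hleft A (A.projectionOnto B hAB) (by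
      rintro ⟨r, hr⟩
      obtain ⟨b, hb, hb0⟩ := Submodule.exists_mem_ne_zero_of_ne_bot hB
      apply hb0
      have h0 := (Submodule.projectionOnto_apply_eq_zero_iff hAB).2 hb
      simpa [h0] using (LinearMap.congr_fun hr b).symm)
    exact ⟨A.subtype ∘ₗ l, fun x => congrArg Subtype.val (LinearMap.congr_fun hl x)⟩
  intro N₁ N₂ hc
  by_contra! hne
  obtain ⟨l₁, h₁⟩ := key N₁ N₂ hc hne.2
  obtain ⟨l₂, h₂⟩ := key N₂ N₁ hc.symm hne.1
  refine hi ⟨l₁ + l₂, LinearMap.ext fun x => ?_⟩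
  simpa [h₁, h₂] using Submodule.projection_add_projection_eq_self hc x

theorem IsAlmostSplitSeq.indecMod_right {K P M : Type} [AddCommGroup K] [Module R K]
    [AddCommGroup P] [Module R P] [AddCommGroup M] [Module R M] {i : K →ₗ[R] P} {p : P →ₗ[R] M}
    (h : IsAlmostSplitSeq R i p) [IsNoetherian R M] : IndecMod R M := by
  obtain ⟨-, -, hp, hright, -⟩ := h
  refine ⟨not_subsingleton_iff_nontrivial.1 fun _ => hp ⟨0, Subsingleton.elim _ _⟩, ?_⟩
  have key : ∀ (A B : Submodule R M), IsCompl A B → B ≠ ⊥ →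
      ∃ l : A →ₗ[R] P, ∀ x : A, p (l x) = x := by
    intro A B hAB hB
    obtain ⟨l, hl⟩ := hright A A.subtype (by
      rintro ⟨s, hs⟩
      apply hB
      have hA : A = ⊤ := eq_top_iff.2 fun x _ => by
        have : ((s x : A) : M) = x := LinearMap.congr_fun hs x
        exact this ▸ (s x).2
      simpa [hA] using hAB.inf_eq_bot)
    exact ⟨l, fun x => LinearMap.congr_fun hl x⟩
  intro N₁ N₂ hc
  by_contra! hne
  obtain ⟨l₁, h₁⟩ := key N₁ N₂ hc hne.2
  obtain ⟨l₂, h₂⟩ := key N₂ N₁ hc.symm hne.1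
  refine hp ⟨l₁ ∘ₗ N₁.projectionOnto N₂ hc + l₂ ∘ₗ N₂.projectionOnto N₁ hc.symm,
    LinearMap.ext fun x => ?_⟩
  simpa [h₁, h₂] using Submodule.projection_add_projection_eq_self hc x

/-- If `0 → K → P → M → 0` is almost split with `P` projective-injective and `K` contained in the
radical of `P`, then the sequence given by a projective cover of `K` is almost split. -/
theorem IsAlmostSplitSeq.syzygy [IsArtinianRing R] (hself : Module.Injective R R)
    (hsimple : ∀ (S : Type) [AddCommGroup S] [Module R S] [IsSimpleModule R S],
      ∃ f : S →ₗ[R] R, Injective f)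
    {K P M Q : Type} [AddCommGroup K] [Module R K] [AddCommGroup P] [Module R P]
    [AddCommGroup M] [Module R M] [AddCommGroup Q] [Module R Q] [Module.Finite R K]
    [Module.Finite R P] [Module.Finite R Q] [Module.Projective R P]
    {i : K →ₗ[R] P} {p : P →ₗ[R] M} (h : IsAlmostSplitSeq R i p)
    (hrad : ∀ x, i x ∈ Module.jacobson R P) (hK : ¬ Module.Projective R K)
    {q : Q →ₗ[R] K} (hq : IsProjCover R q) :
    IsAlmostSplitSeq R (LinearMap.ker q).subtype q := by
  obtain ⟨⟨hi, hp, hex⟩, -, -, hright, hleft⟩ := h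
  obtain ⟨hQ, hqs, hqsup⟩ := hq
  have hPinj := injective_of_projective hself P
  have hpi : ∀ x, p (i x) = 0 := hex.apply_apply_eq_zero
  have hqex := exact_subtype_ker q
  have hι := (LinearMap.ker q).subtype_injective
  set ι := (LinearMap.ker q).subtype
  have hqι : ∀ x, q (ι x) = 0 := hqex.apply_apply_eq_zero
  have hsec : ¬ ∃ s : K →ₗ[R] Q, q ∘ₗ s = LinearMap.id := fun ⟨s, hs⟩ =>
    hK (Module.Projective.of_split s q hs)
  refine ⟨⟨hι, hqs, hqex⟩, ?_, hsec, ?_, ?_⟩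
  · rintro ⟨r, hr⟩
    exact hsec (section_of_retraction hqs hqex hr)
  · intro Z _ _ _ t ht
    obtain ⟨n, j, hj⟩ := exists_injective_to_free hself hsimple Z
    obtain ⟨g, hg⟩ := hPinj.out j hj (i ∘ₗ t)
    have hπex := exact_mkQ_range j
    have hπ := (LinearMap.range j).mkQ_surjective
    set π := (LinearMap.range j).mkQ
    have hπj : ∀ x, π (j x) = 0 := hπex.apply_apply_eq_zero
    obtain ⟨t', ht'⟩ := exists_factor_through_coker hπ hπex (p ∘ₗ g)
      (fun x => by simp [hg, hpi])
    by_cases hs : ∃ s, t' ∘ₗ s = LinearMap.id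
    · obtain ⟨s, hs⟩ := hs
      obtain ⟨s₁, hs₁⟩ := Module.projective_lifting_property π (s ∘ₗ p) hπ
      replace hs : ∀ x, t' (s x) = x := fun x => LinearMap.congr_fun hs x
      replace hs₁ : ∀ x, π (s₁ x) = s (p x) := fun x => LinearMap.congr_fun hs₁ x
      obtain ⟨s₂, hs₂⟩ := exists_factor_through_ker hj hπex (s₁ ∘ₗ i)
        (fun x => by simp [hs₁, hpi])
      obtain ⟨f, hf⟩ := exists_factor_through_ker hi hex (g ∘ₗ s₁ - LinearMap.id)
        (fun x => by
          have := ht' (s₁ x)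
          rw [hs₁, hs] at this
          simp [this])
      refine absurd (section_of_bijective_comp t s₂ (bijective_of_sub_mem_jacobson _ ?_)) ht
      intro x
      have : (t ∘ₗ s₂) x - x = f (i x) := hi <| by
        have h1 := hg (s₂ x)
        rw [hs₂] at h1
        simpa [hf] using h1.symm
      rw [this]
      exact Module.le_comap_jacobson f (hrad x)
    · obtain ⟨l, hl⟩ := hright _ t' hs
      replace hl : ∀ x, p (l x) = t' x := fun x => LinearMap.congr_fun hl x
      obtain ⟨h', hh'⟩ := exists_factor_through_ker hi hex (g - l ∘ₗ π)
        (fun x => by simp [hl, ht'])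
      obtain ⟨h₁, hh₁⟩ := Module.projective_lifting_property q h' hqs
      refine ⟨h₁ ∘ₗ j, LinearMap.ext fun z => hi ?_⟩
      have : q (h₁ (j z)) = h' (j z) := LinearMap.congr_fun hh₁ _
      simp [this, hh', hg, hπj]
  · intro Z _ _ _ t ht
    obtain ⟨n, j, hj⟩ := exists_injective_to_free hself hsimple Z
    have hF : Module.Injective R (Fin n → R) := injective_pi _ fun _ => hself
    obtain ⟨g, hg⟩ := hF.out ι hι (j ∘ₗ t)
    have hπex := exact_mkQ_range j
    have hπ := (LinearMap.range j).mkQ_surjective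
    set π := (LinearMap.range j).mkQ
    have hπj : ∀ x, π (j x) = 0 := hπex.apply_apply_eq_zero
    obtain ⟨t', ht'⟩ := exists_factor_through_coker hqs hqex (π ∘ₗ g)
      (fun x => by simp [hg, hπj])
    by_cases hr : ∃ r, r ∘ₗ t' = LinearMap.id
    · obtain ⟨r, hr⟩ := hr
      obtain ⟨r₁, hr₁⟩ := Module.projective_lifting_property q (r ∘ₗ π) hqs
      replace hr : ∀ x, r (t' x) = x := fun x => LinearMap.congr_fun hr x
      replace hr₁ : ∀ x, q (r₁ x) = r (π x) := fun x => LinearMap.congr_fun hr₁ x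
      obtain ⟨r₂, hr₂⟩ := exists_factor_through_ker hι hqex (r₁ ∘ₗ j)
        (fun x => by simp [hr₁, hπj])
      obtain ⟨f, hf⟩ := exists_factor_through_ker hι hqex (r₁ ∘ₗ g - LinearMap.id)
        (fun x => by
          have := hr (q x)
          rw [ht', LinearMap.comp_apply] at this
          simp [hr₁, this])
      refine absurd (retraction_of_bijective_comp t r₂ (bijective_of_sub_mem_jacobson _ ?_)) ht
      intro x
      have : (r₂ ∘ₗ t) x - x = f (ι x) := hι <| by
        rw [map_sub, LinearMap.comp_apply, hr₂, hf, LinearMap.comp_apply, LinearMap.sub_apply,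
          LinearMap.comp_apply, hg]
        rfl
      rw [this]
      exact Module.le_comap_jacobson f (le_jacobson_of_superfluous hqsup x.2)
    · obtain ⟨l, hl⟩ := hleft _ t' hr
      replace hl : ∀ x, l (i x) = t' x := fun x => LinearMap.congr_fun hl x
      obtain ⟨l₁, hl₁⟩ := Module.projective_lifting_property π l hπ
      replace hl₁ : ∀ x, π (l₁ x) = l x := fun x => LinearMap.congr_fun hl₁ x
      obtain ⟨h', hh'⟩ := exists_factor_through_ker hj hπex (g - l₁ ∘ₗ i ∘ₗ q)
        (fun x => by simp [hl₁, hl, ht'])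
      refine ⟨h', LinearMap.ext fun x => hj ?_⟩
      simp [hh', hg, hqι]

/-- If `0 → K → P → M → 0` is almost split with `P` projective-injective, then the sequence given
by an injective envelope of `M` is almost split. -/
theorem IsAlmostSplitSeq.cosyzygy [IsArtinianRing R] (hself : Module.Injective R R)
    {K P M I C : Type} [AddCommGroup K] [Module R K] [AddCommGroup P] [Module R P]
    [AddCommGroup M] [Module R M] [AddCommGroup I] [Module R I] [AddCommGroup C] [Module R C]
    [Module.Finite R P] [Module.Finite R M] [Module.Finite R C]
    [Module.Projective R P] {i : K →ₗ[R] P} {p : P →ₗ[R] M} (h : IsAlmostSplitSeq R i p)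
    (hM : ¬ Module.Injective R M) {j : M →ₗ[R] I} (hj : IsInjEnvelope R j)
    {c : I →ₗ[R] C} (hc : Surjective c) (hjc : Exact j c) : IsAlmostSplitSeq R j c := by
  have hindec := h.indecMod_right
  obtain ⟨⟨hi, hp, hex⟩, -, hpsec, hright, hleft⟩ := h
  obtain ⟨hI, hj, hess⟩ := hj
  have hPinj := injective_of_projective hself P
  have hpi : ∀ x, p (i x) = 0 := hex.apply_apply_eq_zero
  have hcj : ∀ x, c (j x) = 0 := hjc.apply_apply_eq_zero
  have hret : ¬ ∃ r : I →ₗ[R] M, r ∘ₗ j = LinearMap.id := fun ⟨r, hr⟩ =>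
    hM (injective_of_retraction hI j r hr)
  refine ⟨⟨hj, hc, hjc⟩, hret, ?_, ?_, ?_⟩
  · rintro ⟨s, hs⟩
    exact hret (retraction_of_section hj hjc hs)
  · intro Z _ _ _ t ht
    obtain ⟨n, π, hπ⟩ := Module.Finite.exists_fin' R Z
    have hF : Module.Injective R (Fin n → R) := injective_pi _ fun _ => hself
    obtain ⟨g, hg⟩ := Module.projective_lifting_property c (t ∘ₗ π) hc
    replace hg : ∀ x, c (g x) = t (π x) := fun x => LinearMap.congr_fun hg x
    have hπex := exact_subtype_ker π
    have hι := (LinearMap.ker π).subtype_injective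
    set ι := (LinearMap.ker π).subtype
    have hπι : ∀ x, π (ι x) = 0 := hπex.apply_apply_eq_zero
    obtain ⟨t', ht'⟩ := exists_factor_through_ker hj hjc (g ∘ₗ ι) (fun x => by simp [hg, hπι])
    by_cases hs : ∃ s, t' ∘ₗ s = LinearMap.id
    · obtain ⟨s, hs⟩ := hs
      replace hs : ∀ x, t' (s x) = x := fun x => LinearMap.congr_fun hs x
      obtain ⟨s₁, hs₁⟩ := hF.out j hj (ι ∘ₗ s)
      obtain ⟨s₂, hs₂⟩ := exists_factor_through_coker hc hjc (π ∘ₗ s₁)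
        (fun x => by simp [hs₁, hπι])
      obtain ⟨f, hf⟩ := exists_factor_through_coker hc hjc (g ∘ₗ s₁ - LinearMap.id)
        (fun x => by
          have := ht' (s x)
          rw [hs] at this
          simp only [LinearMap.comp_apply] at this
          simp [hs₁, ← this])
      refine absurd (section_of_bijective_comp t s₂ (bijective_of_eq_on_simple _ ?_)) ht
      intro S hS x hx
      have hfx : f x ∈ LinearMap.range j := by
        have hle : S.map f ≤ LinearMap.range j := by
          by_cases h0 : S.map f = ⊥
          · simp [h0]
          have hne : f ∘ₗ S.subtype ≠ 0 := fun h => h0 <| by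
            rw [← LinearMap.range_eq_bot, LinearMap.range_comp, Submodule.range_subtype] at h
            exact h
          have hinj := LinearMap.injective_of_ne_zero hne
          have e : S ≃ₗ[R] S.map f := (LinearEquiv.ofInjective _ hinj).trans
            (LinearEquiv.ofEq _ _ (by rw [LinearMap.range_comp, Submodule.range_subtype]))
          have hatom : IsAtom (S.map f) :=
            isSimpleModule_iff_isAtom.1 (IsSimpleModule.congr e.symm)
          exact inf_eq_left.1 ((hatom.le_iff.1 inf_le_left).resolve_left (hess _ h0))
        exact hle ⟨x, hx, rfl⟩
      obtain ⟨y, rfl⟩ := hc x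
      have h1 : c (f (c y)) = 0 := (hjc _).2 hfx
      rw [hf] at h1
      simp only [LinearMap.sub_apply, LinearMap.comp_apply, map_sub, hg, LinearMap.id_apply,
        sub_eq_zero] at h1
      simpa [hs₂] using h1
    · obtain ⟨l, hl⟩ := hright _ t' hs
      replace hl : ∀ x, p (l x) = t' x := fun x => LinearMap.congr_fun hl x
      obtain ⟨l₁, hl₁⟩ := hPinj.out ι hι l
      obtain ⟨h', hh'⟩ := exists_factor_through_coker hπ hπex (g - j ∘ₗ p ∘ₗ l₁)
        (fun x => by simp [hl₁, hl, ht'])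
      refine ⟨h', LinearMap.ext fun z => ?_⟩
      obtain ⟨x, rfl⟩ := hπ z
      simp [hh', hg, hcj]
  · intro Z _ _ _ t ht
    obtain ⟨n, π, hπ⟩ := Module.Finite.exists_fin' R Z
    have hF : Module.Injective R (Fin n → R) := injective_pi _ fun _ => hself
    obtain ⟨g, hg⟩ := Module.projective_lifting_property π (t ∘ₗ p) hπ
    replace hg : ∀ x, π (g x) = t (p x) := fun x => LinearMap.congr_fun hg x
    have hπex := exact_subtype_ker π
    have hι := (LinearMap.ker π).subtype_injective
    set ι := (LinearMap.ker π).subtype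
    have hπι : ∀ x, π (ι x) = 0 := hπex.apply_apply_eq_zero
    obtain ⟨t', ht'⟩ := exists_factor_through_ker hι hπex (g ∘ₗ i) (fun x => by simp [hg, hpi])
    by_cases hr : ∃ r, r ∘ₗ t' = LinearMap.id
    · obtain ⟨r, hr⟩ := hr
      replace hr : ∀ x, r (t' x) = x := fun x => LinearMap.congr_fun hr x
      obtain ⟨r₁, hr₁⟩ := hPinj.out ι hι (i ∘ₗ r)
      obtain ⟨r₂, hr₂⟩ := exists_factor_through_coker hπ hπex (p ∘ₗ r₁)
        (fun x => by simp [hr₁, hpi])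
      obtain ⟨f, hf⟩ := exists_factor_through_coker hp hex (r₁ ∘ₗ g - LinearMap.id)
        (fun x => by
          have := hr₁ (t' x)
          rw [ht', LinearMap.comp_apply, LinearMap.comp_apply, hr] at this
          simp [this])
      refine absurd (retraction_of_bijective_comp t r₂
        (hindec.bijective_of_eq_add (p ∘ₗ f) _ ?_ ?_)) ht
      · exact fun hb => hpsec (section_of_bijective_comp p f hb)
      · intro x
        obtain ⟨y, rfl⟩ := hp x
        simp only [LinearMap.comp_apply, hf, LinearMap.sub_apply, LinearMap.id_apply, map_sub,
          ← hg, hr₂]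
        abel
    · obtain ⟨l, hl⟩ := hleft _ t' hr
      replace hl : ∀ x, l (i x) = t' x := fun x => LinearMap.congr_fun hl x
      obtain ⟨h', hh'⟩ := exists_factor_through_coker hp hex (g - ι ∘ₗ l)
        (fun x => by simp [hl, ht'])
      obtain ⟨h₁, hh₁⟩ := hF.out j hj h'
      refine ⟨π ∘ₗ h₁, LinearMap.ext fun x => ?_⟩
      obtain ⟨y, rfl⟩ := hp x
      simp [hh₁, hh', hg, hπι]

/-- An almost split sequence `0 → M → I → C → 0` with projective middle term may be replaced by
the sequence given by a projective cover of `C`. -/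
theorem IsAlmostSplitSeq.of_isProjCover [IsNoetherianRing R] {M I C Q : Type} [AddCommGroup M]
    [Module R M] [AddCommGroup I] [Module R I] [AddCommGroup C] [Module R C] [AddCommGroup Q]
    [Module R Q] [Module.Finite R Q] [Module.Projective R I] {j : M →ₗ[R] I} {c : I →ₗ[R] C}
    (h : IsAlmostSplitSeq R j c) (hC : ¬ Module.Projective R C) {q : Q →ₗ[R] C}
    (hq : IsProjCover R q) : IsAlmostSplitSeq R (LinearMap.ker q).subtype q := by
  obtain ⟨⟨hj, hc, hjc⟩, -, -, hright, hleft⟩ := h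
  obtain ⟨hQ, hqs, hqsup⟩ := hq
  have hqex := exact_subtype_ker q
  have hι := (LinearMap.ker q).subtype_injective
  have hcj : ∀ x, c (j x) = 0 := hjc.apply_apply_eq_zero
  have hsec : ¬ ∃ s : C →ₗ[R] Q, q ∘ₗ s = LinearMap.id := fun ⟨s, hs⟩ =>
    hC (Module.Projective.of_split s q hs)
  obtain ⟨a, ha⟩ := Module.projective_lifting_property c q hc
  obtain ⟨b, hb⟩ := Module.projective_lifting_property q c hqs
  replace ha : ∀ x, c (a x) = q x := fun x => LinearMap.congr_fun ha x
  have hb' : ∀ x, q (b x) = c x := fun x => LinearMap.congr_fun hb x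
  have hbij : Bijective (b ∘ₗ a) := by
    refine IsNoetherian.bijective_of_surjective_endomorphism _ (LinearMap.range_eq_top.1 ?_)
    refine hqsup _ (eq_top_iff.2 fun x _ => ?_)
    rw [← add_sub_cancel ((b ∘ₗ a) x) x]
    refine Submodule.add_mem_sup ⟨x, rfl⟩ ?_
    rw [LinearMap.mem_ker, map_sub, LinearMap.comp_apply, hb', ha, sub_self]
  refine ⟨⟨hι, hqs, hqex⟩, ?_, hsec, ?_, ?_⟩
  · rintro ⟨r, hr⟩
    exact hsec (section_of_retraction hqs hqex hr)
  · intro Z _ _ _ t ht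
    obtain ⟨l, hl⟩ := hright Z t ht
    exact ⟨b ∘ₗ l, by rw [← LinearMap.comp_assoc, hb, hl]⟩
  · intro Z _ _ _ t ht
    obtain ⟨β, hβ⟩ := exists_factor_through_ker hι hqex (b ∘ₗ j) (fun x => by simp [hb', hcj])
    let e := LinearEquiv.ofBijective _ hbij
    have he : ∀ x, b (a (e.symm x)) = x := e.apply_symm_apply
    have hlift : ∀ x : LinearMap.ker q, ∃ m, j m = a (e.symm x) ∧ β m = x := by
      intro x
      have hx : c (a (e.symm x)) = 0 := by
        rw [← hb', he]
        exact x.2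
      obtain ⟨m, hm⟩ := (hjc _).1 hx
      refine ⟨m, hm, hι ?_⟩
      rw [hβ, LinearMap.comp_apply, hm, he]
      rfl
    by_cases hr : ∃ r, r ∘ₗ (t ∘ₗ β) = LinearMap.id
    · obtain ⟨r, hr⟩ := hr
      refine absurd ⟨β ∘ₗ r, LinearMap.ext fun x => ?_⟩ ht
      obtain ⟨m, -, rfl⟩ := hlift x
      exact congrArg β (LinearMap.congr_fun hr m)
    · obtain ⟨l, hl⟩ := hleft Z _ hr
      refine ⟨l ∘ₗ a ∘ₗ e.symm.toLinearMap, LinearMap.ext fun x => ?_⟩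
      obtain ⟨m, hm, hmx⟩ := hlift x
      calc l (a (e.symm x)) = l (j m) := by rw [hm]
        _ = t (β m) := LinearMap.congr_fun hl m
        _ = t x := by rw [hmx]

end AlmostSplit

theorem statement17 [Module.Finite k Λ] [IsArtinianRing k]
    -- Λ is non-semisimple, self-injective, of finite representation type
    (hnss : ¬ IsSemisimpleRing Λ)
    (hself : Module.Injective Λ Λ)
    (hrep : FiniteRepType Λ)
    -- M is an indecomposable non-projective f.g. Λ-module with property (*)
    (M : Type) [AddCommGroup M] [Module Λ M] [Module.Finite Λ M]
    (hM : Pstar Λ M) :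
    -- the syzygy has property (*), and the sequence 0 → Ω(M) → P → M → 0 is almost split
    (∀ (P : ModuleCat.{0} Λ) (p : (P : Type) →ₗ[Λ] M), Module.Finite Λ P →
      IsProjCover Λ p →
        Pstar Λ (LinearMap.ker p : Type) ∧ ¬ Module.Projective Λ (LinearMap.ker p : Type) ∧
        IndecMod Λ (LinearMap.ker p : Type) ∧
        IsAlmostSplitSeq Λ ((LinearMap.ker p).subtype) p) ∧
    -- the cosyzygy has property (*), and the sequence 0 → M → I → Ω⁻¹(M) → 0 is almost split
    (∀ (I : ModuleCat.{0} Λ) (j : M →ₗ[Λ] (I : Type)), Module.Finite Λ I →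
      IsInjEnvelope Λ j →
        Pstar Λ ((I : Type) ⧸ LinearMap.range j) ∧
        ¬ Module.Projective Λ ((I : Type) ⧸ LinearMap.range j) ∧
        IndecMod Λ ((I : Type) ⧸ LinearMap.range j) ∧
        IsAlmostSplitSeq Λ j ((LinearMap.range j).mkQ)) := by
  have : IsArtinianRing Λ := IsArtinianRing.of_finite k Λ
  have hsimple : ∀ (S : Type) [AddCommGroup S] [Module Λ S] [IsSimpleModule Λ S],
      ∃ f : S →ₗ[Λ] Λ, Injective f := fun S =>
    exists_injective_of_isSimpleModule k hself hrep S
  obtain ⟨-, hMproj, hMstar⟩ := hM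
  constructor
  · intro P p hP hp
    have hseq := hMstar P p hP hp
    have hPproj := hp.1
    have hindec : IndecMod Λ (LinearMap.ker p) := hseq.indecMod_left
    have hK : ¬ Module.Projective Λ (LinearMap.ker p) := fun _ =>
      hseq.2.1 (retraction_of_injective (injective_of_projective hself _) hseq.1.1)
    refine ⟨⟨hindec, hK, fun Q q hQ hq => ?_⟩, hK, hindec, hseq⟩
    exact hseq.syzygy hself hsimple (fun x => le_jacobson_of_superfluous hp.2.2 x.2) hK hq
  · intro I j hI hj
    obtain ⟨P, p, hP, hp⟩ := exists_isProjCover (R := Λ) M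
    have hPproj := hp.1
    have hIproj := projective_of_injective hself hsimple I hj.1
    have hMinj : ¬ Module.Injective Λ M := fun h =>
      hMproj (projective_of_injective hself hsimple M h)
    have hseq := (hMstar P p hP hp).cosyzygy hself hMinj hj (Submodule.mkQ_surjective _)
      (exact_mkQ_range j)
    have hindec : IndecMod Λ ((I : Type) ⧸ LinearMap.range j) := hseq.indecMod_right
    have hC : ¬ Module.Projective Λ ((I : Type) ⧸ LinearMap.range j) := fun _ =>
      hseq.2.2.1 (Module.projective_lifting_property _ LinearMap.id (Submodule.mkQ_surjective _))
    exact ⟨⟨hindec, hC, fun Q q _ hq => hseq.of_isProjCover hC hq⟩, hC, hindec, hseq⟩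

end Statement17
end

section
/- Let Λ be a non-semisimple self-injective Artin algebra of finite representation type over the commutative artinian ring k, and let M be an indecomposable non-projective finitely generated Λ-module with property (*). Let P1 →w P0 → M → 0 be a minimal projective presentation of M. Then ν(P1) ≅ P0 as right Λ-modules, where ν(P) = D(Hom_Λ(P,Λ)) is the Nakayama functor. -/
/-!
STATEMENT 18: Let Λ be a non-semisimple self-injective Artin algebra of finite
representation type over a commutative artinian ring k, and M an indecomposable
non-projective f.g. Λ-module with property (*).  If P1 →w P0 → M → 0 is a minimal
projective presentation of M, then ν(P1) ≅ P0, where ν(P) = D(Hom_Λ(P,Λ)) is the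
Nakayama functor (the isomorphism being an isomorphism of Λ-modules, where Λ acts on
ν(P1) via the right action (φ·c)(x) = φ(x)·c of Λ on Hom_Λ(P1,Λ)).
-/

open Function

namespace Statement18

variable (k : Type) [CommRing k]
variable (Λ : Type) [Ring Λ] [Algebra k Λ]

/-- An indecomposable module. -/
def IndecMod (V : Type) [AddCommGroup V] [Module Λ V] : Prop :=
  Nontrivial V ∧ ∀ N₁ N₂ : Submodule Λ V, IsCompl N₁ N₂ → N₁ = ⊥ ∨ N₂ = ⊥

/-- Finite representation type. -/
def FiniteRepType : Prop :=
  ∃ (n : ℕ) (rep : Fin n → ModuleCat.{0} Λ),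
    ∀ (V : ModuleCat.{0} Λ), Module.Finite Λ V → IndecMod Λ V →
      ∃ i, Nonempty ((V : Type) ≃ₗ[Λ] (rep i : Type))

/-- `(i, p)` is an almost split sequence of finitely generated Λ-modules. -/
def IsAlmostSplitSeq {T B C : Type} [AddCommGroup T] [Module Λ T]
    [AddCommGroup B] [Module Λ B] [AddCommGroup C] [Module Λ C]
    (i : T →ₗ[Λ] B) (p : B →ₗ[Λ] C) : Prop :=
  (Function.Injective i ∧ Function.Surjective p ∧ Function.Exact i p) ∧
  ¬ (∃ r : B →ₗ[Λ] T, r ∘ₗ i = LinearMap.id) ∧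
  ¬ (∃ s : C →ₗ[Λ] B, p ∘ₗ s = LinearMap.id) ∧
  (∀ (Z : Type) [AddCommGroup Z] [Module Λ Z] [Module.Finite Λ Z],
    ∀ t : Z →ₗ[Λ] C, ¬ (∃ s : C →ₗ[Λ] Z, t ∘ₗ s = LinearMap.id) →
      ∃ l : Z →ₗ[Λ] B, p ∘ₗ l = t) ∧
  (∀ (Z : Type) [AddCommGroup Z] [Module Λ Z] [Module.Finite Λ Z],
    ∀ t : T →ₗ[Λ] Z, ¬ (∃ r : Z →ₗ[Λ] T, r ∘ₗ t = LinearMap.id) →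
      ∃ l : B →ₗ[Λ] Z, l ∘ₗ i = t)

/-- `p : P → V` is a projective cover. -/
def IsProjCover {P V : Type} [AddCommGroup P] [Module Λ P] [AddCommGroup V] [Module Λ V]
    (p : P →ₗ[Λ] V) : Prop :=
  Module.Projective Λ P ∧ Function.Surjective p ∧
    ∀ N : Submodule Λ P, N ⊔ LinearMap.ker p = ⊤ → N = ⊤

/-- Property (*). -/
def Pstar (V : Type) [AddCommGroup V] [Module Λ V] : Prop :=
  IndecMod Λ V ∧ ¬ Module.Projective Λ V ∧
  ∀ (P : ModuleCat.{0} Λ) (p : (P : Type) →ₗ[Λ] V), Module.Finite Λ P →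
    IsProjCover Λ p →
      IsAlmostSplitSeq Λ ((LinearMap.ker p).subtype) p

/-- The right Λ-action `φ ↦ φ(−)·c` on `Hom_Λ(P, Λ)`. -/
def rsmul (P : Type) [AddCommGroup P] [Module Λ P] (c : Λ) (φ : P →ₗ[Λ] Λ) :
    P →ₗ[Λ] Λ where
  toFun x := φ x * c
  map_add' x y := by simp [add_mul]
  map_smul' a x := by simp [smul_eq_mul, mul_assoc]

/-- The right Λ-action on `Hom_Λ(P, Λ)`, bundled as a k-linear map. -/
def rsmulMap (P : Type) [AddCommGroup P] [Module Λ P] (c : Λ) :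
    (P →ₗ[Λ] Λ) →ₗ[k] (P →ₗ[Λ] Λ) where
  toFun φ := rsmul Λ P c φ
  map_add' φ ψ := by ext x; simp [rsmul, add_mul]
  map_smul' a φ := by ext x; simp [rsmul, smul_mul_assoc]

section InjectiveModules

variable {R : Type} [Ring R]

/-- A map into an injective module factors through any map with smaller kernel. -/
theorem exists_comp_eq_of_ker_le {A B Q : Type} [AddCommGroup A] [Module R A]
    [AddCommGroup B] [Module R B] [AddCommGroup Q] [Module R Q] (hQ : Module.Injective R Q)
    (f : A →ₗ[R] B) (g : A →ₗ[R] Q) (hfg : LinearMap.ker f ≤ LinearMap.ker g) :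
    ∃ h : B →ₗ[R] Q, ∀ a, h (f a) = g a := by
  have hinj : Function.Injective ((LinearMap.ker f).liftQ f le_rfl) := by
    rw [← LinearMap.ker_eq_bot, Submodule.ker_liftQ_eq_bot _ _ _ le_rfl]
  obtain ⟨h, hh⟩ := hQ.out _ hinj ((LinearMap.ker f).liftQ g hfg)
  exact ⟨h, fun a => by simpa using hh (Submodule.Quotient.mk a)⟩

theorem injective_of_retract {A B : Type} [AddCommGroup A] [Module R A] [AddCommGroup B]
    [Module R B] (hB : Module.Injective R B) (s : A →ₗ[R] B) (r : B →ₗ[R] A)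
    (hrs : r ∘ₗ s = LinearMap.id) : Module.Injective R A where
  out X Y _ _ _ _ f hf g := by
    obtain ⟨h, hh⟩ := hB.out f hf (s ∘ₗ g)
    refine ⟨r ∘ₗ h, fun x => ?_⟩
    simpa [hh] using LinearMap.congr_fun hrs (g x)

/-- Over a self-injective ring, finitely generated projective modules are injective. -/
theorem injective_of_finite_projective (hR : Module.Injective R R) (P : Type) [AddCommGroup P]
    [Module R P] [Module.Finite R P] [Module.Projective R P] : Module.Injective R P := by
  obtain ⟨n, f, g, -, -, hfg⟩ := Module.Finite.exists_comp_eq_id_of_projective R P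
  exact injective_of_retract inferInstance g f hfg

/-- The kernel of a projective cover of an indecomposable module is essential, provided the
covering module is injective and the kernel is not a direct summand. -/
theorem ker_essential_of_indecomposable {P M : Type} [AddCommGroup P] [Module R P]
    [AddCommGroup M] [Module R M] [IsArtinian R P] [IsNoetherian R P]
    (hP : Module.Injective R P) (hM : IndecMod R M) (p : P →ₗ[R] M)
    (hp : Function.Surjective p)
    (hns : ¬ ∃ r : P →ₗ[R] LinearMap.ker p, r ∘ₗ (LinearMap.ker p).subtype = LinearMap.id)
    (N : Submodule R P) (hN : Disjoint N (LinearMap.ker p)) : N = ⊥ := by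
  obtain ⟨g, hg⟩ := exists_comp_eq_of_ker_le hP (N.mkQ ∘ₗ (LinearMap.ker p).subtype)
    (LinearMap.ker p).subtype (by
      intro x hx
      have hxN : (x : P) ∈ N := by simpa using hx
      simpa using Submodule.disjoint_def.mp hN x hxN x.2)
  set h : Module.End R P := g ∘ₗ N.mkQ with hdef
  have hK : ∀ n : ℕ, ∀ x ∈ LinearMap.ker p, (h ^ n) x = x := by
    intro n x hx
    have hx1 : h x = x := hg ⟨x, hx⟩
    induction n with
    | zero => simp
    | succ n ih => rw [pow_succ, Module.End.mul_apply, hx1, ih]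
  obtain ⟨n, hn, hcompl⟩ := ((Filter.eventually_ge_atTop 1).and
    h.eventually_isCompl_ker_pow_range_pow).exists
  set A := LinearMap.ker (h ^ n)
  set B := LinearMap.range (h ^ n)
  have hNA : N ≤ A := by
    intro x hx
    obtain ⟨m, rfl⟩ : ∃ m, n = m + 1 := ⟨n - 1, by omega⟩
    have : h x = 0 := by simp [hdef, (Submodule.Quotient.mk_eq_zero N).mpr hx]
    simp [A, pow_succ, Module.End.mul_apply, this]
  have hKB : LinearMap.ker p ≤ B := fun x hx => ⟨x, hK n x hx⟩
  have hmap : IsCompl (A.map p) (B.map p) := by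
    constructor
    · rw [Submodule.disjoint_def]
      rintro _ ⟨a, ha, rfl⟩ ⟨b, hb, hab⟩
      have hba : b - a ∈ B := hKB (by simp [hab])
      have haB : a ∈ B := by simpa using B.sub_mem hb hba
      simp [Submodule.disjoint_def.mp hcompl.disjoint a ha haB]
    · rw [codisjoint_iff, ← Submodule.map_sup, hcompl.sup_eq_top, Submodule.map_top,
        LinearMap.range_eq_top.mpr hp]
  rcases hM.2 _ _ hmap with hA | hB
  · have hAK : A ≤ LinearMap.ker p := by rwa [LinearMap.le_ker_iff_map]
    exact le_bot_iff.mp (hNA.trans (hcompl.disjoint le_rfl (hAK.trans hKB)))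
  · have hBK : B ≤ LinearMap.ker p := by rwa [LinearMap.le_ker_iff_map]
    refine absurd ⟨(h ^ n).codRestrict _ fun x => hBK ⟨x, rfl⟩, ?_⟩ hns
    ext x
    exact hK n x x.2

/-- If a projective cover sequence is almost split, then the kernel is simple. -/
theorem isSimpleModule_ker_of_isAlmostSplitSeq {P M : Type} [AddCommGroup P] [Module R P]
    [AddCommGroup M] [Module R M] [Module.Finite R P] [IsNoetherianRing R] (p : P →ₗ[R] M)
    (hsup : ∀ N : Submodule R P, N ⊔ LinearMap.ker p = ⊤ → N = ⊤)
    (h : IsAlmostSplitSeq R (LinearMap.ker p).subtype p) :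
    IsSimpleModule R (LinearMap.ker p) := by
  obtain ⟨-, hns, -, -, hleft⟩ := h
  have : Nontrivial (LinearMap.ker p) := by
    by_contra hcon
    rw [not_nontrivial_iff_subsingleton] at hcon
    exact hns ⟨0, LinearMap.ext fun x => Subsingleton.elim _ _⟩
  rw [isSimpleModule_iff]
  refine { exists_pair_ne := exists_pair_ne _, eq_bot_or_eq_top := fun L => ?_ }
  by_cases hL : L = ⊥
  · exact Or.inl hL
  right
  obtain ⟨l, hl⟩ := hleft (LinearMap.ker p ⧸ L) L.mkQ (by
    rintro ⟨r, hr⟩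
    have hinj : Function.Injective L.mkQ :=
      Function.LeftInverse.injective (g := r) fun x => LinearMap.congr_fun hr x
    rw [← LinearMap.ker_eq_bot, Submodule.ker_mkQ] at hinj
    exact hL hinj)
  have hker : LinearMap.ker l = ⊤ := by
    refine hsup _ (eq_top_iff.mpr fun x _ => ?_)
    obtain ⟨y, hy⟩ := L.mkQ_surjective (l x)
    have hly : l y = l x := (LinearMap.congr_fun hl y).trans hy
    rw [← sub_add_cancel x (y : P)]
    exact Submodule.add_mem_sup (by simp [hly]) y.2
  rw [← Submodule.ker_mkQ L, ← hl, LinearMap.ker_eq_top.mp hker]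
  simp

end InjectiveModules

section Duality

variable {k : Type} [CommRing k]

/-- In an artinian ring, every maximal ideal annihilates a nonzero element modulo the radical. -/
theorem exists_notMem_jacobson_mul_mem [IsArtinianRing k] (m : Ideal k) [hm : m.IsMaximal] :
    ∃ e : k, e ∉ Ideal.jacobson (⊥ : Ideal k) ∧
      ∀ a ∈ m, a * e ∈ Ideal.jacobson (⊥ : Ideal k) := by
  classical
  set S := (IsArtinianRing.setOfPred_isMaximal_finite k).toFinset.erase m with hS
  have hnle : ¬ S.inf id ≤ m := by
    rw [hm.isPrime.inf_le']
    rintro ⟨J, hJ, hJm⟩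
    rw [hS, Finset.mem_erase, Set.Finite.mem_toFinset] at hJ
    exact hJ.1 (Ideal.IsMaximal.eq_of_le hJ.2 hm.ne_top hJm)
  obtain ⟨e, heS, hem⟩ := SetLike.not_le_iff_exists.mp hnle
  refine ⟨e, fun he => hem ?_, fun a ha => ?_⟩
  · exact (Submodule.mem_sInf.mp he) m ⟨bot_le, hm⟩
  · refine Submodule.mem_sInf.mpr fun J hJ => ?_
    by_cases hJm : J = m
    · exact hJm ▸ m.mul_mem_right e ha
    · refine Ideal.mul_mem_left J a ?_
      have hle : S.inf id ≤ J := Finset.inf_le (f := id) (by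
        rw [hS, Finset.mem_erase, Set.Finite.mem_toFinset]
        exact ⟨hJm, hJ.2⟩)
      exact hle heS

variable {E : Type} [AddCommGroup E] [Module k E]
  {φ : (k ⧸ Ideal.jacobson (⊥ : Ideal k)) →ₗ[k] E}

/-- An injective module containing `k / rad k` is a cogenerator. -/
theorem exists_dual_apply_ne_zero [IsArtinianRing k] (hE : Module.Injective k E)
    (hφ : Function.Injective φ) {X : Type} [AddCommGroup X] [Module k X] {x : X} (hx : x ≠ 0) :
    ∃ θ : X →ₗ[k] E, θ x ≠ 0 := by
  have hann : LinearMap.ker (LinearMap.toSpanSingleton k X x) ≠ ⊤ := by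
    intro h
    have : (1 : k) ∈ LinearMap.ker (LinearMap.toSpanSingleton k X x) := h ▸ Submodule.mem_top
    exact hx (by simpa using this)
  obtain ⟨m, hm, hle⟩ := Ideal.exists_le_maximal _ hann
  obtain ⟨e, he, hme⟩ := exists_notMem_jacobson_mul_mem m
  obtain ⟨θ, hθ⟩ := exists_comp_eq_of_ker_le hE (LinearMap.toSpanSingleton k X x)
    (φ ∘ₗ LinearMap.toSpanSingleton k _ (Ideal.Quotient.mk _ e)) (by
      intro a ha
      have : a • (Ideal.Quotient.mk (Ideal.jacobson (⊥ : Ideal k)) e) = 0 :=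
        Ideal.Quotient.eq_zero_iff_mem.mpr (hme a (hle ha))
      simp [this])
  refine ⟨θ, fun h0 => he ?_⟩
  have h1 := hθ 1
  simp only [LinearMap.toSpanSingleton_apply, one_smul, LinearMap.comp_apply, h0] at h1
  exact Ideal.Quotient.eq_zero_iff_mem.mp (hφ (by rw [← h1, map_zero]))

/-- Simple submodules of an essential extension of `k / rad k` lie in `k / rad k`. -/
theorem dual_simple_mem_range (hess : ∀ N : Submodule k E, N ≠ ⊥ → N ⊓ LinearMap.range φ ≠ ⊥)
    {S : Type} [AddCommGroup S] [Module k S] [IsSimpleModule k S] (a : S →ₗ[k] E) (s : S) :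
    a s ∈ LinearMap.range φ := by
  by_cases has : a s = 0
  · exact has ▸ Submodule.zero_mem _
  obtain ⟨y, hy, hy0⟩ := Submodule.exists_mem_ne_zero_of_ne_bot
    (hess (k ∙ a s) (by simpa using has))
  obtain ⟨c, rfl⟩ := Submodule.mem_span_singleton.mp hy.1
  have hcs : c • s ≠ 0 := fun h => hy0 (by rw [← map_smul, h, map_zero])
  obtain ⟨d, hd⟩ := IsSimpleModule.toSpanSingleton_surjective k hcs s
  have hd' : d • c • s = s := hd
  rw [← hd', map_smul, map_smul]
  exact Submodule.smul_mem _ d hy.2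

/-- The Matlis dual of a simple module has length at most one. -/
theorem length_dual_simple_le (hφ : Function.Injective φ)
    (hess : ∀ N : Submodule k E, N ≠ ⊥ → N ⊓ LinearMap.range φ ≠ ⊥)
    (S : Type) [AddCommGroup S] [Module k S] [IsSimpleModule k S] :
    Module.length k (S →ₗ[k] E) ≤ 1 := by
  rcases subsingleton_or_nontrivial (S →ₗ[k] E) with hsub | hnt
  · simp
  suffices IsSimpleModule k (S →ₗ[k] E) by
    rw [Module.length_eq_one]
  rw [isSimpleModule_iff_toSpanSingleton_surjective]
  refine ⟨hnt, fun a ha b => ?_⟩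
  obtain ⟨s, hs⟩ : ∃ s, a s ≠ 0 := by
    by_contra! hcon
    exact ha (LinearMap.ext hcon)
  have hs0 : s ≠ 0 := fun h => hs (by rw [h, map_zero])
  obtain ⟨α', hα'⟩ := dual_simple_mem_range hess a s
  obtain ⟨β', hβ'⟩ := dual_simple_mem_range hess b s
  obtain ⟨α, rfl⟩ := Ideal.Quotient.mk_surjective α'
  obtain ⟨β, rfl⟩ := Ideal.Quotient.mk_surjective β'
  have hαs : α • s ≠ 0 := by
    intro h
    have h0 : φ (α • Ideal.Quotient.mk _ α) = 0 := by
      rw [map_smul, hα', ← map_smul, h, map_zero]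
    have h1 : α • Ideal.Quotient.mk (Ideal.jacobson (⊥ : Ideal k)) α = 0 :=
      hφ (by rw [h0, map_zero])
    have h2 : α * α ∈ Ideal.jacobson (⊥ : Ideal k) := Ideal.Quotient.eq_zero_iff_mem.mp h1
    have h3 : α ∈ Ideal.jacobson (⊥ : Ideal k) :=
      Ideal.isRadical_jacobson _ ⟨2, by rwa [pow_two]⟩
    exact hs (by rw [← hα', Ideal.Quotient.eq_zero_iff_mem.mpr h3, map_zero])
  obtain ⟨c, hc⟩ := IsSimpleModule.toSpanSingleton_surjective k hαs s
  have hc' : c • α • s = s := hc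
  have hcomm : β • a s = α • b s := by
    rw [← hα', ← hβ', ← φ.map_smul, ← φ.map_smul]
    exact congrArg (φ ∘ Ideal.Quotient.mk _) (mul_comm β α)
  refine ⟨c * β, LinearMap.ext fun t => ?_⟩
  obtain ⟨d, hd⟩ := IsSimpleModule.toSpanSingleton_surjective k hs0 t
  have hd' : d • s = t := hd
  have hbs : b s = (c * β) • a s := by
    rw [mul_smul, hcomm, ← map_smul, ← map_smul, hc']
  simp only [LinearMap.toSpanSingleton_apply, LinearMap.smul_apply, ← hd', map_smul, hbs]

/-- Matlis duality does not increase the length of a module of finite length. -/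
theorem length_dual_le (hφ : Function.Injective φ)
    (hess : ∀ N : Submodule k E, N ≠ ⊥ → N ⊓ LinearMap.range φ ≠ ⊥)
    {X : Type} [AddCommGroup X] [Module k X] (hX : IsFiniteLength k X) :
    Module.length k (X →ₗ[k] E) ≤ Module.length k X := by
  induction hX with
  | of_subsingleton => simp
  | @of_simple_quotient X _ _ N _ hN ih =>
    let res : (X →ₗ[k] E) →ₗ[k] (N →ₗ[k] E) := N.subtype.lcomp k E
    have hker : Module.length k (LinearMap.ker res) ≤ Module.length k ((X ⧸ N) →ₗ[k] E) := by
      have hle : ∀ f : LinearMap.ker res, N ≤ LinearMap.ker f.1 := fun f x hx =>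
        LinearMap.congr_fun f.2 ⟨x, hx⟩
      let lift : LinearMap.ker res →ₗ[k] ((X ⧸ N) →ₗ[k] E) :=
        { toFun := fun f => N.liftQ f.1 (hle f)
          map_add' := fun f g => by ext; rfl
          map_smul' := fun c f => by ext; rfl }
      refine Module.length_le_of_injective lift fun f g hfg => ?_
      ext x
      exact LinearMap.congr_fun hfg (Submodule.Quotient.mk x)
    rw [Module.length_eq_add_of_exact (LinearMap.ker res).subtype res.rangeRestrict
        (Submodule.subtype_injective _) res.surjective_rangeRestrict
        (by rw [LinearMap.exact_iff]; simp),
      Module.length_eq_add_of_exact N.subtype N.mkQ N.subtype_injective N.mkQ_surjective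
        (by rw [LinearMap.exact_iff]; simp), add_comm]
    refine add_le_add ((Module.length_le_of_injective (LinearMap.range res).subtype
      (Submodule.subtype_injective _)).trans ih) (hker.trans ?_)
    rw [Module.length_eq_one k (X ⧸ N)]
    exact length_dual_simple_le hφ hess _

end Duality

section Pairing

variable {k Λ : Type} [CommRing k] [Ring Λ] [Algebra k Λ]
  {E P₀ P₁ : Type} [AddCommGroup E] [Module k E] [AddCommGroup P₀] [Module Λ P₀] [Module k P₀]
  [IsScalarTower k Λ P₀] [AddCommGroup P₁] [Module Λ P₁]

/-- The pairing `P₀ × Hom_Λ(P₁, Λ) → E` attached to a functional on `Hom_Λ(P₁, P₀)`. -/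
def nuPairing (θ : (P₁ →ₗ[Λ] P₀) →ₗ[k] E) : P₀ →ₗ[k] (P₁ →ₗ[Λ] Λ) →ₗ[k] E :=
  LinearMap.mk₂ k (fun x f => θ (f.smulRight x))
    (fun x y f => by rw [← map_add]; congr 1; ext; simp)
    (fun c x f => by rw [← map_smul]; congr 1; ext; simp [smul_comm c])
    (fun x f g => by rw [← map_add]; congr 1; ext; simp [add_smul])
    (fun c x f => by rw [← map_smul]; congr 1; ext; simp)

theorem nuPairing_apply (θ : (P₁ →ₗ[Λ] P₀) →ₗ[k] E) (x : P₀) (f : P₁ →ₗ[Λ] Λ) :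
    nuPairing θ x f = θ (f.smulRight x) := rfl

theorem nuPairing_smul (θ : (P₁ →ₗ[Λ] P₀) →ₗ[k] E) (c : Λ) (x : P₀) :
    nuPairing θ (c • x) = nuPairing θ x ∘ₗ rsmulMap k Λ P₁ c := by
  ext f
  simp only [nuPairing_apply, LinearMap.comp_apply]
  congr 1
  ext y
  simp [rsmulMap, rsmul, mul_smul]

/-- The kernel of `x ↦ nuPairing θ x` as a `Λ`-submodule. -/
def nuKer (θ : (P₁ →ₗ[Λ] P₀) →ₗ[k] E) : Submodule Λ P₀ where
  carrier := {x | nuPairing θ x = 0}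
  add_mem' {x y} hx hy := by
    change nuPairing θ (x + y) = 0
    rw [map_add, show nuPairing θ x = 0 from hx, show nuPairing θ y = 0 from hy, add_zero]
  zero_mem' := map_zero _
  smul_mem' c x hx := by
    change nuPairing θ (c • x) = 0
    rw [nuPairing_smul, show nuPairing θ x = 0 from hx, LinearMap.zero_comp]

theorem mem_nuKer {θ : (P₁ →ₗ[Λ] P₀) →ₗ[k] E} {x : P₀} :
    x ∈ nuKer θ ↔ nuPairing θ x = 0 := Iff.rfl

/-- A functional not vanishing on `w` does not pair the image of `w` to zero. -/
theorem not_range_le_nuKer [Module.Finite Λ P₁] [Module.Projective Λ P₁]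
    {θ : (P₁ →ₗ[Λ] P₀) →ₗ[k] E} {w : P₁ →ₗ[Λ] P₀} (hθ : θ w ≠ 0) :
    ¬ LinearMap.range w ≤ nuKer θ := by
  intro hle
  obtain ⟨n, f, g, -, -, hfg⟩ := Module.Finite.exists_comp_eq_id_of_projective Λ P₁
  have hw : w = ∑ i, (LinearMap.proj i ∘ₗ g).smulRight (w (f (Pi.single i 1))) := by
    ext y
    have hy : f (g y) = y := LinearMap.congr_fun hfg y
    conv_lhs => rw [← hy, pi_eq_sum_univ' (g y)]
    simp [map_sum]
  apply hθ
  rw [hw, map_sum]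
  refine Finset.sum_eq_zero fun i _ => ?_
  rw [← nuPairing_apply, mem_nuKer.mp (hle ⟨_, rfl⟩), LinearMap.zero_apply]

theorem nuPairing_injective [Module.Finite Λ P₁] [Module.Projective Λ P₁]
    {θ : (P₁ →ₗ[Λ] P₀) →ₗ[k] E} {w : P₁ →ₗ[Λ] P₀} (hθ : θ w ≠ 0)
    [IsSimpleModule Λ (LinearMap.range w)]
    (hess : ∀ N : Submodule Λ P₀, Disjoint N (LinearMap.range w) → N = ⊥) :
    Function.Injective (nuPairing θ) := by
  have hatom : IsAtom (LinearMap.range w) := isSimpleModule_iff_isAtom.mp inferInstance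
  have hbot := hess (nuKer θ)
    ((hatom.not_le_iff_disjoint.mp (not_range_le_nuKer hθ)).symm)
  rw [injective_iff_map_eq_zero]
  intro x hx
  rw [← Submodule.mem_bot Λ, ← hbot]
  exact hx

theorem nuPairing_flip_injective (hP₀ : Module.Injective Λ P₀)
    {θ : (P₁ →ₗ[Λ] P₀) →ₗ[k] E} {w : P₁ →ₗ[Λ] P₀} (hθ : θ w ≠ 0)
    [IsSimpleModule Λ (LinearMap.range w)]
    (hsup : ∀ N : Submodule Λ P₁, N ⊔ LinearMap.ker w = ⊤ → N = ⊤) :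
    Function.Injective (nuPairing θ).flip := by
  rw [injective_iff_map_eq_zero]
  intro f hf
  by_contra hf0
  have hmax : IsCoatom (LinearMap.ker w) := by
    rw [← isSimpleModule_iff_isCoatom]
    exact IsSimpleModule.congr w.quotKerEquivRange
  have hle : LinearMap.ker f ≤ LinearMap.ker w := by
    by_contra hnle
    refine hf0 (LinearMap.ker_eq_top.mp (hsup _ ?_))
    rw [sup_comm]
    exact hmax.2 _ (left_lt_sup.mpr hnle)
  obtain ⟨h, hh⟩ := exists_comp_eq_of_ker_le hP₀ f w hle
  have hsr : f.smulRight (h 1) = w := by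
    ext y
    rw [LinearMap.smulRight_apply, ← map_smul, smul_eq_mul, mul_one, hh]
  apply hθ
  rw [← hsr, ← nuPairing_apply, ← LinearMap.flip_apply, hf, LinearMap.zero_apply]

end Pairing

theorem finite_dual [IsNoetherianRing k] [Module.Finite k Λ] (P : Type) [AddCommGroup P]
    [Module Λ P] [Module.Finite Λ P] : Module.Finite k (P →ₗ[Λ] Λ) := by
  obtain ⟨n, s, hs⟩ := Module.Finite.exists_fin (R := Λ) (M := P)
  let ev : (P →ₗ[Λ] Λ) →ₗ[k] (Fin n → Λ) :=
    { toFun := fun f i => f (s i)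
      map_add' := fun f g => rfl
      map_smul' := fun c f => rfl }
  refine Module.Finite.of_injective ev fun f g hfg => ?_
  refine LinearMap.ext_on_range hs fun i => congrFun hfg i

/-- An injective map that is injective in the other variable is an isomorphism onto the dual. -/
theorem bijective_of_flip_injective {E : Type} [AddCommGroup E] [Module k E]
    {φ : (k ⧸ Ideal.jacobson (⊥ : Ideal k)) →ₗ[k] E} (hφ : Function.Injective φ)
    (hess : ∀ N : Submodule k E, N ≠ ⊥ → N ⊓ LinearMap.range φ ≠ ⊥)
    {X Y : Type} [AddCommGroup X] [Module k X] [AddCommGroup Y] [Module k Y]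
    (hX : IsFiniteLength k X) (hY : IsFiniteLength k Y) (B : X →ₗ[k] Y →ₗ[k] E)
    (hB : Function.Injective B) (hB' : Function.Injective B.flip) : Function.Bijective B := by
  refine ⟨hB, ?_⟩
  have hlen : Module.length k (Y →ₗ[k] E) ≤ Module.length k X :=
    (length_dual_le hφ hess hY).trans
      ((Module.length_le_of_injective _ hB').trans (length_dual_le hφ hess hX))
  have hfin : IsFiniteLength k (Y →ₗ[k] E) :=
    Module.length_ne_top_iff.mp (ne_top_of_le_ne_top (Module.length_ne_top_iff.mpr hX) hlen)
  obtain ⟨_, _⟩ := isFiniteLength_iff_isNoetherian_isArtinian.mp hfin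
  rw [← LinearMap.range_eq_top]
  by_contra hne
  have hlt := Submodule.length_lt hne
  rw [← (LinearEquiv.ofInjective B hB).length_eq] at hlt
  exact hlt.not_ge hlen

theorem statement18 [IsArtinianRing k] [Module.Finite k Λ]
    -- the injective envelope E of k/r and the duality D = Hom_k(−,E)
    (E : Type) [AddCommGroup E] [Module k E] (hEinj : Module.Injective k E)
    (φ : (k ⧸ Ideal.jacobson (⊥ : Ideal k)) →ₗ[k] E)
    (hφmono : Function.Injective φ)
    (hφess : ∀ N : Submodule k E, N ≠ ⊥ → N ⊓ LinearMap.range φ ≠ ⊥)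
    -- Λ is non-semisimple, self-injective, of finite representation type
    (hnss : ¬ IsSemisimpleRing Λ)
    (hself : Module.Injective Λ Λ)
    (hrep : FiniteRepType Λ)
    -- M : an indecomposable non-projective f.g. Λ-module with property (*)
    (M : Type) [AddCommGroup M] [Module Λ M] [Module.Finite Λ M]
    (hM : Pstar Λ M)
    -- the minimal projective presentation P1 →w P0 → M → 0 of M
    (P₀ P₁ : Type) [AddCommGroup P₀] [Module Λ P₀] [Module.Finite Λ P₀]
    [AddCommGroup P₁] [Module Λ P₁] [Module.Finite Λ P₁]
    (w : P₁ →ₗ[Λ] P₀) (e₀ : P₀ →ₗ[Λ] M)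
    (hP₀ : Module.Projective Λ P₀) (hP₁ : Module.Projective Λ P₁)
    (he₀ : Function.Surjective e₀) (hwe : Function.Exact w e₀)
    (hcover₀ : ∀ N : Submodule Λ P₀, N ⊔ LinearMap.ker e₀ = ⊤ → N = ⊤)
    (hcover₁ : ∀ N : Submodule Λ P₁, N ⊔ LinearMap.ker w = ⊤ → N = ⊤) :
    -- conclusion: ν(P1) = D(Hom_Λ(P1,Λ)) is isomorphic to P0 as a Λ-module, i.e.
    -- there is an additive isomorphism intertwining the Λ-actions
    ∃ e : ((P₁ →ₗ[Λ] Λ) →ₗ[k] E) ≃+ P₀,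
      ∀ (ψ : (P₁ →ₗ[Λ] Λ) →ₗ[k] E) (c : Λ),
        e (ψ ∘ₗ rsmulMap k Λ P₁ c) = c • e ψ := by
  let _ : Module k P₀ := Module.compHom P₀ (algebraMap k Λ)
  have : IsScalarTower k Λ P₀ :=
    ⟨fun a b x => by rw [Algebra.smul_def, mul_smul]; rfl⟩
  have : Module.Finite k P₀ := Module.Finite.trans Λ P₀
  have : IsArtinianRing Λ := IsArtinianRing.of_finite k Λ
  have hinj₀ : Module.Injective Λ P₀ := injective_of_finite_projective hself P₀
  have hAS : IsAlmostSplitSeq Λ (LinearMap.ker e₀).subtype e₀ :=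
    hM.2.2 (ModuleCat.of Λ P₀) e₀ ‹_› ⟨hP₀, he₀, hcover₀⟩
  have hker : LinearMap.ker e₀ = LinearMap.range w := LinearMap.exact_iff.mp hwe
  have hess := ker_essential_of_indecomposable hinj₀ hM.1 e₀ he₀ hAS.2.1
  have hsimple := isSimpleModule_ker_of_isAlmostSplitSeq e₀ hcover₀ hAS
  rw [hker] at hess hsimple
  have hw : w ≠ 0 := by
    rintro rfl
    rw [LinearMap.range_zero] at hsimple
    exact not_nontrivial _ (IsSimpleModule.nontrivial Λ (⊥ : Submodule Λ P₀))
  obtain ⟨θ, hθ⟩ := exists_dual_apply_ne_zero hEinj hφmono hw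
  have := finite_dual k Λ P₁
  have hbij := bijective_of_flip_injective k hφmono hφess
    (isFiniteLength_iff_isNoetherian_isArtinian.mpr ⟨inferInstance, inferInstance⟩)
    (isFiniteLength_iff_isNoetherian_isArtinian.mpr ⟨inferInstance, inferInstance⟩)
    (nuPairing θ) (nuPairing_injective hθ hess) (nuPairing_flip_injective hinj₀ hθ hcover₁)
  let e : P₀ ≃ₗ[k] ((P₁ →ₗ[Λ] Λ) →ₗ[k] E) := LinearEquiv.ofBijective (nuPairing θ) hbij
  refine ⟨e.symm.toAddEquiv, fun ψ c => ?_⟩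
  obtain ⟨x, rfl⟩ := e.surjective ψ
  change e.symm (nuPairing θ x ∘ₗ rsmulMap k Λ P₁ c) = c • e.symm (e x)
  rw [← nuPairing_smul, e.symm_apply_apply]
  exact e.symm_apply_apply _

end Statement18
end
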